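/- arXiv:math/0204075 — 6 statements merged into one kernel-verified Lean document; each statement's English description precedes it below -/
import Mathlib

section
/- Let x, z, t be elements of A satisfying x·z = q·z·x, z·t = q·t·z and x·t = q·t·x + λ·z². Then for every natural number n, (x + b·z + t)^n = Σ_{i=0}^{n} Σ_{j=0}^{i} C(n,i)_q · C(i,j)_q · ν(i−j) · t^j · z^{i−j} · x^{n−i}. -/
/-- The q-integer `(n)_q = 1 + q + ⋯ + q^(n-1)`. -/
def qInt {k : Type*} [Field k] (q : k) (n : ℕ) : k := ∑ i ∈ Finset.range n, q ^ i

/-- The Gaussian (q-)binomial coefficient `C(n,i)_q`, defined via the q-Pascal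
recursion; it vanishes when `i > n`. -/
def qBinom {k : Type*} [Field k] (q : k) : ℕ → ℕ → k
  | _, 0 => 1
  | 0, _ + 1 => 0
  | n + 1, i + 1 => qBinom q n i + q ^ (i + 1) * qBinom q n (i + 1)

/-- The recursively defined sequence `ν(0) = 1`, `ν(1) = b`,
`ν(n) = b·ν(n-1) + λ·(n-1)_q·ν(n-2)`. -/
def nuSeq {k : Type*} [Field k] (q b lam : k) : ℕ → k
  | 0 => 1
  | 1 => b
  | n + 2 => b * nuSeq q b lam (n + 1) + lam * qInt q (n + 1) * nuSeq q b lam n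

theorem qInt_succ_eq_one_add {k : Type*} [Field k] (q : k) (n : ℕ) :
    qInt q (n + 1) = 1 + q * qInt q n := by
  simp only [qInt, Finset.sum_range_succ', Finset.mul_sum, pow_succ', pow_zero]
  ring

theorem qInt_add {k : Type*} [Field k] (q : k) (m n : ℕ) :
    qInt q (m + n) = qInt q m + q ^ m * qInt q n := by
  simp only [qInt, Finset.sum_range_add, Finset.mul_sum, pow_add]

@[simp]
theorem qInt_zero {k : Type*} [Field k] (q : k) : qInt q 0 = 0 := by simp [qInt]

@[simp]
theorem qBinom_zero_right {k : Type*} [Field k] (q : k) (n : ℕ) : qBinom q n 0 = 1 := by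
  cases n <;> rfl

theorem qBinom_succ_succ {k : Type*} [Field k] (q : k) (n i : ℕ) :
    qBinom q (n + 1) (i + 1) = qBinom q n i + q ^ (i + 1) * qBinom q n (i + 1) := rfl

theorem qBinom_eq_zero_of_lt {k : Type*} [Field k] (q : k) {n i : ℕ} (h : n < i) :
    qBinom q n i = 0 := by
  induction n generalizing i with
  | zero => obtain ⟨i, rfl⟩ := Nat.exists_eq_succ_of_ne_zero h.ne'; rfl
  | succ n ih =>
    obtain ⟨i, rfl⟩ := Nat.exists_eq_succ_of_ne_zero (Nat.ne_zero_of_lt h)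
    rw [Nat.succ_eq_add_one, qBinom_succ_succ, ih (by omega), ih (by omega), mul_zero, add_zero]

theorem qBinom_succ_right_mul_qInt {k : Type*} [Field k] (q : k) (n j : ℕ) :
    qBinom q n (j + 1) * qInt q (j + 1) = qBinom q n j * qInt q (n - j) := by
  induction n generalizing j with
  | zero => simp [qBinom]
  | succ n ih =>
    cases j with
    | zero =>
      have h := ih 0
      have h1 : qInt q 1 = 1 := by simp [qInt]
      simp only [zero_add, h1, qBinom_zero_right, Nat.sub_zero, mul_one, one_mul] at h ⊢
      rw [← zero_add 1, qBinom_succ_succ, qBinom_zero_right, zero_add, pow_one, h,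
        qInt_succ_eq_one_add]
    | succ j =>
      rw [qBinom_succ_succ, qBinom_succ_succ, Nat.add_sub_add_right]
      rcases lt_or_ge j n with hj | hj
      · obtain ⟨m, rfl⟩ := Nat.exists_eq_add_of_lt hj
        have h1 := ih j
        have h2 := ih (j + 1)
        have e1 := qInt_add q (j + 1) (m + 1)
        have e2 := qInt_add q (j + 2) m
        rw [show j + 1 + (m + 1) = j + 2 + m by ring] at e1
        rw [show j + m + 1 - j = m + 1 by omega] at h1 ⊢
        rw [show j + m + 1 - (j + 1) = m by omega] at h2
        linear_combination h1 + q ^ (j + 2) * h2 +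
          qBinom q (j + m + 1) (j + 1) * (e1 - e2)
      · rw [qBinom_eq_zero_of_lt q (show n < j + 1 by omega),
          qBinom_eq_zero_of_lt q (show n < j + 1 + 1 by omega), Nat.sub_eq_zero_of_le hj]
        simp

/-- Reindexing of a `q`-binomial sum by means of the `q`-Pascal recursion. -/
theorem sum_qBinom_succ_smul {k M : Type*} [Field k] [AddCommGroup M] [Module k M]
    (q : k) (n : ℕ) (f : ℕ → M) :
    ∑ j ∈ Finset.range (n + 2), qBinom q (n + 1) j • f j =
      ∑ j ∈ Finset.range (n + 1), qBinom q n j • (f (j + 1) + q ^ j • f j) := by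
  have h : ∑ j ∈ Finset.range (n + 1), (q ^ j * qBinom q n j) • f j =
      f 0 + ∑ j ∈ Finset.range (n + 1), (q ^ (j + 1) * qBinom q n (j + 1)) • f (j + 1) := by
    have h' := Finset.sum_range_succ (fun j => (q ^ j * qBinom q n j) • f j) (n + 1)
    rw [qBinom_eq_zero_of_lt q (Nat.lt_succ_self n), Finset.sum_range_succ'] at h'
    simpa [add_comm] using h'.symm
  rw [Finset.sum_range_succ']
  simp only [qBinom_succ_succ, add_smul, smul_add, Finset.sum_add_distrib, smul_smul,
    qBinom_zero_right, one_smul]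
  simp only [mul_comm (qBinom q n _) (q ^ _)]
  rw [h]
  abel

theorem nuSeq_succ {k : Type*} [Field k] (q b lam : k) (n : ℕ) :
    nuSeq q b lam (n + 1) =
      b * nuSeq q b lam n + lam * qInt q n * nuSeq q b lam (n - 1) := by
  cases n <;> simp [nuSeq]

section QCommute

variable {k A : Type*} [Field k] [Ring A] [Algebra k A] {q : k}

theorem mul_pow_of_qCommute {u v : A} (h : u * v = q • (v * u)) (m : ℕ) :
    u * v ^ m = q ^ m • (v ^ m * u) := by
  induction m with
  | zero => simp
  | succ m ih =>
    rw [pow_succ, ← mul_assoc, ih, smul_mul_assoc, mul_assoc, h, mul_smul_comm, smul_smul,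
      ← pow_succ, mul_assoc]

theorem mul_pow_succ_of_qWeyl {lam : k} {x z t : A} (hzt : z * t = q • (t * z))
    (hxt : x * t = q • (t * x) + lam • z ^ 2) (j : ℕ) :
    x * t ^ (j + 1) = q ^ (j + 1) • (t ^ (j + 1) * x) +
      (lam * q ^ j * qInt q (j + 1)) • (t ^ j * z ^ 2) := by
  induction j with
  | zero => simpa [qInt] using hxt
  | succ j ih =>
    have hz : z ^ 2 * t = q ^ 2 • (t * z ^ 2) := by
      rw [sq, mul_assoc, hzt, mul_smul_comm, ← mul_assoc, hzt, smul_mul_assoc, smul_smul,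
        mul_assoc, sq]
    rw [pow_succ t (j + 1), ← mul_assoc, ih, add_mul, smul_mul_assoc, smul_mul_assoc,
      mul_assoc, hxt, mul_assoc (t ^ j), hz, qInt_succ_eq_one_add q (j + 1), mul_add, mul_smul_comm,
      mul_smul_comm, mul_smul_comm, ← mul_assoc, ← mul_assoc, ← pow_succ, ← pow_succ]
    module

/-- The part of the expansion free of `x`, written with `t` to the left of `z`. -/
def tzSum (q b lam : k) (z t : A) (i : ℕ) : A :=
  ∑ j ∈ Finset.range (i + 1), qBinom q i j • nuSeq q b lam (i - j) • (t ^ j * z ^ (i - j))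

theorem mul_tzSum {lam : k} {x z t : A} (b : k) (hxz : x * z = q • (z * x))
    (hzt : z * t = q • (t * z)) (hxt : x * t = q • (t * x) + lam • z ^ 2) (i : ℕ) :
    x * tzSum q b lam z t i = q ^ i • (tzSum q b lam z t i * x) +
      ∑ j ∈ Finset.range (i + 1), (qBinom q i j * q ^ j * lam * qInt q (i - j) *
        nuSeq q b lam (i - j - 1)) • (t ^ j * z ^ (i + 1 - j)) := by
  have hterm (j m : ℕ) : x * (t ^ j * z ^ m) = q ^ (j + m) • (t ^ j * z ^ m * x) +
      (lam * q ^ (j - 1) * qInt q j) • (t ^ (j - 1) * z ^ (m + 2)) := by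
    have hx := mul_pow_of_qCommute hxz m
    cases j with
    | zero => simpa using hx
    | succ j =>
      rw [← mul_assoc, mul_pow_succ_of_qWeyl hzt hxt, add_mul, smul_mul_assoc, smul_mul_assoc,
        mul_assoc, hx, mul_smul_comm, smul_smul, ← pow_add, mul_assoc, mul_assoc, ← pow_add,
        Nat.add_sub_cancel, ← mul_assoc, add_comm 2 m, ← mul_assoc]
  have hrest : ∑ j ∈ Finset.range (i + 1), (qBinom q i j * nuSeq q b lam (i - j) *
        (lam * q ^ (j - 1) * qInt q j)) • (t ^ (j - 1) * z ^ (i - j + 2)) =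
      ∑ j ∈ Finset.range (i + 1), (qBinom q i j * q ^ j * lam * qInt q (i - j) *
        nuSeq q b lam (i - j - 1)) • (t ^ j * z ^ (i + 1 - j)) := by
    rw [Finset.sum_range_succ', Finset.sum_range_succ _ i]
    simp only [qInt_zero, Nat.sub_self, mul_zero, zero_mul, zero_smul, add_zero]
    refine Finset.sum_congr rfl fun j hj => ?_
    have hj := Finset.mem_range.mp hj
    rw [Nat.add_sub_cancel, show i - (j + 1) + 2 = i + 1 - j by omega, ← Nat.sub_sub]
    congr 1
    linear_combination lam * q ^ j * nuSeq q b lam (i - j - 1) *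
      qBinom_succ_right_mul_qInt q i j
  rw [← hrest, tzSum, Finset.mul_sum, Finset.sum_mul, Finset.smul_sum,
    ← Finset.sum_add_distrib]
  refine Finset.sum_congr rfl fun j hj => ?_
  have hj := Finset.mem_range.mp hj
  rw [mul_smul_comm, mul_smul_comm, hterm, Nat.add_sub_cancel' (by omega : j ≤ i),
    smul_mul_assoc, smul_mul_assoc]
  module

theorem add_mul_tzSum {lam : k} {x z t : A} (b : k) (hxz : x * z = q • (z * x))
    (hzt : z * t = q • (t * z)) (hxt : x * t = q • (t * x) + lam • z ^ 2) (i : ℕ) :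
    (x + b • z + t) * tzSum q b lam z t i =
      tzSum q b lam z t (i + 1) + q ^ i • (tzSum q b lam z t i * x) := by
  have hsucc : tzSum q b lam z t (i + 1) = t * tzSum q b lam z t i +
      b • z * tzSum q b lam z t i +
      ∑ j ∈ Finset.range (i + 1), (qBinom q i j * q ^ j * lam * qInt q (i - j) *
        nuSeq q b lam (i - j - 1)) • (t ^ j * z ^ (i + 1 - j)) := by
    rw [tzSum, sum_qBinom_succ_smul, tzSum, Finset.mul_sum, Finset.mul_sum,
      ← Finset.sum_add_distrib, ← Finset.sum_add_distrib]
    refine Finset.sum_congr rfl fun j hj => ?_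
    have hj := Finset.mem_range.mp hj
    have hz : z * (t ^ j * z ^ (i - j)) = q ^ j • (t ^ j * z ^ (i - j + 1)) := by
      rw [← mul_assoc, mul_pow_of_qCommute hzt, smul_mul_assoc, mul_assoc, ← pow_succ']
    rw [Nat.add_sub_add_right, show i + 1 - j = i - j + 1 by omega, nuSeq_succ,
      mul_smul_comm, mul_smul_comm, mul_smul_comm, mul_smul_comm, smul_mul_assoc, hz,
      ← mul_assoc t, ← pow_succ']
    module
  rw [add_mul, add_mul, mul_tzSum b hxz hzt hxt, hsucc]
  abel

theorem add_pow_eq_sum_tzSum {lam : k} {x z t : A} (b : k) (hxz : x * z = q • (z * x))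
    (hzt : z * t = q • (t * z)) (hxt : x * t = q • (t * x) + lam • z ^ 2) (n : ℕ) :
    (x + b • z + t) ^ n =
      ∑ i ∈ Finset.range (n + 1), qBinom q n i • (tzSum q b lam z t i * x ^ (n - i)) := by
  induction n with
  | zero => simp [tzSum, nuSeq]
  | succ n ih =>
    rw [pow_succ', ih, sum_qBinom_succ_smul, Finset.mul_sum]
    refine Finset.sum_congr rfl fun i hi => ?_
    have hi := Finset.mem_range.mp hi
    rw [mul_smul_comm, ← mul_assoc, add_mul_tzSum b hxz hzt hxt, add_mul, smul_mul_assoc,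
      mul_assoc _ x, ← pow_succ', Nat.add_sub_add_right, show n - i + 1 = n + 1 - i by omega]

end QCommute

theorem generalized_q_binomial {k A : Type*} [Field k] [Ring A] [Algebra k A]
    (q : k) (hq : q ≠ 0) (lam b : k) (x z t : A)
    (hxz : x * z = q • (z * x)) (hzt : z * t = q • (t * z))
    (hxt : x * t = q • (t * x) + lam • z ^ 2) (n : ℕ) :
    (x + b • z + t) ^ n =
      ∑ i ∈ Finset.range (n + 1), ∑ j ∈ Finset.range (i + 1),
        (qBinom q n i * qBinom q i j * nuSeq q b lam (i - j)) •
          (t ^ j * z ^ (i - j) * x ^ (n - i)) := by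
  rw [add_pow_eq_sum_tzSum b hxz hzt hxt]
  refine Finset.sum_congr rfl fun i _ => ?_
  rw [tzSum, Finset.sum_mul, Finset.smul_sum]
  refine Finset.sum_congr rfl fun j _ => ?_
  rw [smul_mul_assoc, smul_mul_assoc, smul_smul, smul_smul, mul_assoc (qBinom q n i)]
end

section
/- Suppose q is a primitive n-th root of unity with n > 1, and α, β ∈ k satisfy α + β = b and α·β = λ/(q−1). Then ν(n) = α^n + β^n. -/
open Polynomial in
/-- The Rogers–Szegő polynomials `∑ j, [n choose j]_q X ^ j β ^ (n - j)`, defined by their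
three-term recurrence. -/
noncomputable def rogersSzego {k : Type*} [Field k] (q β : k) : ℕ → k[X]
  | 0 => 1
  | 1 => X + C β
  | n + 2 => (X + C β) * rogersSzego q β (n + 1) +
      C β * X * (C q ^ (n + 1) - 1) * rogersSzego q β n

section RogersSzego

open Polynomial

variable {k : Type*} [Field k] (q β : k)

theorem rogersSzego_add_two (n : ℕ) :
    rogersSzego q β (n + 2) = (X + C β) * rogersSzego q β (n + 1) +
      C β * X * (C q ^ (n + 1) - 1) * rogersSzego q β n := rfl

theorem rogersSzego_comp_C_mul_X (n : ℕ) :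
    (rogersSzego q β (n + 1)).comp (C q * X) =
      rogersSzego q β (n + 1) - (1 - C q ^ (n + 1)) * X * rogersSzego q β n := by
  induction n using Nat.twoStepInduction with
  | zero => simp [rogersSzego]; ring
  | one => simp [rogersSzego]; ring
  | more n h₁ h₂ =>
    rw [rogersSzego_add_two q β (n + 1)]
    simp only [add_comp, mul_comp, sub_comp, pow_comp, X_comp, C_comp, one_comp]
    rw [h₂, h₁, rogersSzego_add_two q β n]
    ring

theorem eval_zero_rogersSzego (n : ℕ) : (rogersSzego q β n).eval 0 = β ^ n := by
  induction n using Nat.twoStepInduction with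
  | zero => simp [rogersSzego]
  | one => simp [rogersSzego]
  | more n _ h => simp [rogersSzego_add_two, h]; ring

theorem coeff_rogersSzego_add_two_succ (n j : ℕ) :
    (rogersSzego q β (n + 2)).coeff (j + 1) =
      (rogersSzego q β (n + 1)).coeff j + β * (rogersSzego q β (n + 1)).coeff (j + 1) +
        β * (q ^ (n + 1) - 1) * (rogersSzego q β n).coeff j := by
  have e : rogersSzego q β (n + 2) = X * rogersSzego q β (n + 1) +
      C β * rogersSzego q β (n + 1) +
      X * (C (β * (q ^ (n + 1) - 1)) * rogersSzego q β n) := by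
    rw [rogersSzego_add_two]; simp; ring
  rw [e]
  simp only [coeff_add, coeff_X_mul, coeff_C_mul]

theorem coeff_rogersSzego_of_lt (n : ℕ) : ∀ j, n < j → (rogersSzego q β n).coeff j = 0 := by
  induction n using Nat.twoStepInduction with
  | zero => intro j hj; simp [rogersSzego, coeff_one, hj.ne']
  | one =>
    intro j hj
    simp [rogersSzego, coeff_X, coeff_C, hj.ne, (zero_lt_one.trans hj).ne']
  | more n h₁ h₂ =>
    rintro (_ | j) hj
    · omega
    rw [coeff_rogersSzego_add_two_succ, h₂ j (by omega), h₂ (j + 1) (by omega), h₁ j (by omega)]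
    simp

theorem coeff_rogersSzego_self (n : ℕ) : (rogersSzego q β n).coeff n = 1 := by
  induction n using Nat.twoStepInduction with
  | zero => simp [rogersSzego]
  | one => simp [rogersSzego]
  | more n _ h =>
    rw [coeff_rogersSzego_add_two_succ, h, coeff_rogersSzego_of_lt q β (n + 1) (n + 2) (by omega),
      coeff_rogersSzego_of_lt q β n (n + 1) (by omega)]
    simp

theorem coeff_rogersSzego_eq_zero {n : ℕ} (hq : q ^ n = 1) {j : ℕ} (hj : q ^ j ≠ 1) :
    (rogersSzego q β n).coeff j = 0 := by
  cases n with
  | zero =>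
    refine coeff_rogersSzego_of_lt q β 0 j (Nat.pos_of_ne_zero ?_)
    rintro rfl
    simp at hj
  | succ n =>
    have h := congrArg (fun p => p.coeff j) (rogersSzego_comp_C_mul_X q β n)
    simp only [← C_pow, hq, C_1, sub_self, zero_mul, sub_zero, comp_C_mul_X_coeff] at h
    have h' : (rogersSzego q β (n + 1)).coeff j * (q ^ j - 1) = 0 := by
      rw [mul_sub, h]; ring
    exact (mul_eq_zero.mp h').resolve_right (sub_ne_zero.mpr hj)

theorem nuSeq_eq_eval_rogersSzego {lam : k} (α : k) (hlam : lam = α * β * (q - 1)) (n : ℕ) :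
    nuSeq q (α + β) lam n = (rogersSzego q β n).eval α := by
  induction n using Nat.twoStepInduction with
  | zero => simp [rogersSzego, nuSeq]
  | one => simp [rogersSzego, nuSeq]
  | more n h₁ h₂ =>
    have hg : qInt q (n + 1) * (q - 1) = q ^ (n + 1) - 1 := geom_sum_mul q (n + 1)
    rw [nuSeq, h₁, h₂, rogersSzego_add_two, hlam]
    simp only [eval_add, eval_mul, eval_sub, eval_pow, eval_X, eval_C, eval_one]
    linear_combination α * β * (rogersSzego q β n).eval α * hg

end RogersSzego

theorem nu_primitive_root {k : Type*} [Field k] (q b lam : k) (n : ℕ) (hn : 1 < n)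
    (hq1 : q ^ n = 1) (hq2 : ∀ m : ℕ, 1 ≤ m → m < n → q ^ m ≠ 1)
    (α β : k) (hsum : α + β = b) (hprod : α * β = lam / (q - 1)) :
    nuSeq q b lam n = α ^ n + β ^ n := by
  have hq : q - 1 ≠ 0 := sub_ne_zero.mpr (by simpa using hq2 1 le_rfl hn)
  have hlam : lam = α * β * (q - 1) := by rw [hprod, div_mul_cancel₀ _ hq]
  have hdeg : (rogersSzego q β n).natDegree < n + 1 :=
    Nat.lt_succ_of_le (Polynomial.natDegree_le_iff_coeff_eq_zero.mpr
      (coeff_rogersSzego_of_lt q β n))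
  rw [← hsum, nuSeq_eq_eval_rogersSzego q β α hlam, Polynomial.eval_eq_sum_range' hdeg,
    Finset.sum_range_succ, coeff_rogersSzego_self, one_mul, add_comm,
    Finset.sum_eq_single_of_mem 0 (Finset.mem_range.mpr (by omega)),
    Polynomial.coeff_zero_eq_eval_zero, eval_zero_rogersSzego, pow_zero, mul_one]
  intro j hj hj0
  rw [coeff_rogersSzego_eq_zero q β hq1
    (hq2 j (Nat.one_le_iff_ne_zero.mpr hj0) (Finset.mem_range.mp hj)), zero_mul]
end

section
/- Let X, Y, Z be elements of A and α, β ∈ k scalars such that Y·X = α·X·Y + Z and Z·X = β·X·Z. Then for every natural number n ≥ 1, Y·X^n = α^n·X^n·Y + (Σ_{i=0}^{n−1} α^i·β^{n−1−i})·X^{n−1}·Z. -/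
theorem skew_commutation_pow {k A : Type*} [Field k] [Ring A] [Algebra k A]
    (α β : k) (X Y Z : A)
    (hY : Y * X = α • (X * Y) + Z) (hZ : Z * X = β • (X * Z))
    (n : ℕ) (hn : 1 ≤ n) :
    Y * X ^ n = (α ^ n) • (X ^ n * Y) +
      (∑ i ∈ Finset.range n, α ^ i * β ^ (n - 1 - i)) • (X ^ (n - 1) * Z) := by
  induction n, hn using Nat.le_induction with
  | base => simpa using hY
  | succ n hn ih =>
    have hX : X ^ (n - 1) * X = X ^ n := pow_sub_one_mul (by lia) X
    rw [Nat.add_sub_cancel, geom_sum₂_succ_eq, pow_succ X, ← mul_assoc, ih, add_mul,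
      smul_mul_assoc, smul_mul_assoc, mul_assoc, mul_assoc, hY, hZ, mul_add, mul_smul_comm,
      mul_smul_comm, ← mul_assoc (X ^ n), ← mul_assoc (X ^ (n - 1)), hX, smul_add, smul_smul,
      smul_smul, ← pow_succ, add_assoc, ← add_smul, mul_comm β]
end

section
/- Let X, Y, Z be elements of A and α, β ∈ k scalars such that Y·X = α·X·Y + Z and Z·X = β·X·Z. If α ≠ β and α^n = β^n, then for every n > 1, Y·X^n = α^n·X^n·Y. -/
theorem sub_smul_mul_pow_succ_of_skew_commutation {k A : Type*} [CommRing k] [Ring A] [Algebra k A]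
    {α β : k} {X Y Z : A}
    (hY : Y * X = α • (X * Y) + Z) (hZ : Z * X = β • (X * Z)) (n : ℕ) :
    (α - β) • (Y * X ^ (n + 1)) =
      ((α - β) * α ^ (n + 1)) • (X ^ (n + 1) * Y) + (α ^ (n + 1) - β ^ (n + 1)) • (X ^ n * Z) := by
  induction n with
  | zero => simp [hY, smul_smul]
  | succ n ih =>
    rw [pow_succ X (n + 1), ← mul_assoc, ← smul_mul_assoc, ih]
    simp only [add_mul, smul_mul_assoc, mul_assoc, hY, hZ, mul_add, mul_smul_comm]
    rw [← mul_assoc (X ^ n) X Z, ← pow_succ]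
    module

theorem skew_commutation_pow_of_pow_eq {k A : Type*} [Field k] [Ring A] [Algebra k A]
    (α β : k) (X Y Z : A)
    (hY : Y * X = α • (X * Y) + Z) (hZ : Z * X = β • (X * Z))
    (n : ℕ) (hn : 1 < n) (hne : α ≠ β) (hpow : α ^ n = β ^ n) :
    Y * X ^ n = (α ^ n) • (X ^ n * Y) := by
  obtain ⟨m, rfl⟩ := Nat.exists_eq_add_of_lt hn
  have h := sub_smul_mul_pow_succ_of_skew_commutation hY hZ (1 + m)
  rw [hpow, sub_self, zero_smul, add_zero, mul_smul] at h
  rw [hpow]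
  exact (smul_right_inj (sub_ne_zero.mpr hne)).mp h
end

section
/- Let a₁, a₂ ∈ A, set c = a₂·a₁ − b₂₁·a₁·a₂ and d = a₂·c − b₂₁·q·c·a₂, and assume a₁·c = b₁₂·c·a₁ and d·a₂ = b₁₂·a₂·d. Then d·a₁ = (b₂₁·q)²·a₁·d + b₂₁·q·(q − 1)·c². -/
theorem d_mul_a1 {k A : Type*} [Field k] [Ring A] [Algebra k A]
    (q b12 b21 : k) (hq : q ≠ 0) (hb12 : b12 ≠ 0) (hb21 : b21 ≠ 0)
    (hbraid : b12 * b21 * q ^ 2 = 1)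
    (a1 a2 c d : A)
    (hc : c = a2 * a1 - b21 • (a1 * a2))
    (hd : d = a2 * c - (b21 * q) • (c * a2))
    (ha1c : a1 * c = b12 • (c * a1))
    (hda2 : d * a2 = b12 • (a2 * d)) :
    d * a1 = ((b21 * q) ^ 2) • (a1 * d) + (b21 * q * (q - 1)) • c ^ 2 := by
  have h21 : a2 * a1 = c + b21 • (a1 * a2) := by rw [hc]; abel
  have hca1 : c * a1 = (b21 * q ^ 2) • (a1 * c) := by
    rw [ha1c, smul_smul, show b21 * q ^ 2 * b12 = 1 by linear_combination hbraid, one_smul]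
  have hleft : a2 * c * a1 = (b21 * q ^ 2) • (c * c + b21 • (a1 * (a2 * c))) := by
    rw [mul_assoc, hca1, mul_smul_comm, ← mul_assoc, h21, add_mul, smul_mul_assoc, mul_assoc]
  have hright : c * a2 * a1 = c * c + (b21 * (b21 * q ^ 2)) • (a1 * (c * a2)) := by
    rw [mul_assoc, h21, mul_add, mul_smul_comm, ← mul_assoc, hca1, smul_mul_assoc, smul_smul,
      mul_assoc]
  rw [hd, sub_mul, smul_mul_assoc, hleft, hright, mul_sub, mul_smul_comm, sq c]
  module
end

section
/- Let a₁, a₂ ∈ A, set c = a₂·a₁ − b₂₁·a₁·a₂ and d = a₂·c − b₂₁·q·c·a₂, and assume a₁·c = b₁₂·c·a₁ and d·a₂ = b₁₂·a₂·d. Then c·d = b₁₂·d·c. -/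
theorem c_mul_d {k A : Type*} [Field k] [Ring A] [Algebra k A]
    (q b12 b21 : k) (hq : q ≠ 0) (hb12 : b12 ≠ 0) (hb21 : b21 ≠ 0)
    (hbraid : b12 * b21 * q ^ 2 = 1)
    (a1 a2 c d : A)
    (hc : c = a2 * a1 - b21 • (a1 * a2))
    (hd : d = a2 * c - (b21 * q) • (c * a2))
    (ha1c : a1 * c = b12 • (c * a1))
    (hda2 : d * a2 = b12 • (a2 * d)) :
    c * d = b12 • (d * c) := by
  obtain rfl : b21 = (b12 * q ^ 2)⁻¹ := by
    apply eq_inv_of_mul_eq_one_left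
    linear_combination hbraid
  have h12 : a1 * a2 = (b12 * q ^ 2) • (a2 * a1 - c) := by
    rw [hc, sub_sub_cancel, smul_inv_smul₀ (by positivity)]
  have h2c : a2 * c = d + (b12 * q)⁻¹ • (c * a2) := by
    rw [hd]
    match_scalars <;> field_simp <;> ring
  have h1d : a1 * d = (b12 ^ 2 * q ^ 2) • (d * a1) + (b12 * q * (1 - q)) • (c * c) := by
    have h : a1 * d = (a1 * a2) * c - ((b12 * q ^ 2)⁻¹ * q) • ((a1 * c) * a2) := by
      rw [hd, mul_sub, mul_smul_comm, mul_assoc, mul_assoc]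
    have hl : (a1 * a2) * c = (b12 * q ^ 2) • (b12 • ((a2 * c) * a1) - c * c) := by
      rw [h12, smul_mul_assoc, sub_mul, mul_assoc, ha1c, mul_smul_comm, mul_assoc]
    have hr : (a1 * c) * a2 = b12 • (b12 * q ^ 2) • (c * (a2 * a1) - c * c) := by
      rw [ha1c, smul_mul_assoc, mul_assoc, h12, mul_smul_comm, mul_sub]
    rw [h, hl, hr, h2c, add_mul, smul_mul_assoc, mul_assoc]
    match_scalars <;> field_simp <;> ring
  have h2cc : a2 * (c * c) =
      d * c + (b12 * q)⁻¹ • (c * d) + ((b12 * q)⁻¹ ^ 2) • (c * (c * a2)) := by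
    rw [← mul_assoc, h2c, add_mul, smul_mul_assoc, mul_assoc, h2c, mul_add, mul_smul_comm]
    module
  have hl : (a1 * d) * a2 = (b12 ^ 4 * q ^ 4) • (a2 * (d * a1))
      - (b12 ^ 3 * q ^ 4) • (d * c) + (b12 * q * (1 - q)) • (c * (c * a2)) := by
    rw [h1d, add_mul, smul_mul_assoc, smul_mul_assoc, mul_assoc d, h12, mul_smul_comm, mul_sub,
      ← mul_assoc d a2, hda2, smul_mul_assoc, mul_assoc a2, mul_assoc c]
    module
  have hr : (a1 * d) * a2 = (b12 ^ 2 * q ^ 2) • ((b12 ^ 2 * q ^ 2) • (a2 * (d * a1))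
      + (b12 * q * (1 - q)) • (a2 * (c * c)) - c * d) := by
    rw [mul_assoc, hda2, mul_smul_comm, ← mul_assoc, h12, smul_mul_assoc, sub_mul, mul_assoc,
      h1d, mul_add, mul_smul_comm, mul_smul_comm]
    module
  rw [h2cc, hl] at hr
  have key : (b12 ^ 2 * q ^ 3) • (c * d) = (b12 ^ 2 * q ^ 3) • (b12 • (d * c)) := by
    rw [← sub_eq_zero] at hr ⊢
    rw [← hr]
    match_scalars <;> field_simp <;> ring
  exact smul_right_injective A (mul_ne_zero (pow_ne_zero 2 hb12) (pow_ne_zero 3 hq)) key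
end
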